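/- arXiv:q-alg/9511014 — 2 statements merged into one kernel-verified Lean document; each statement's English description precedes it below -/
import Mathlib

section
/- Let l ≥ 1 be an integer and q a nonzero complex number with q² ≠ 1. The image of the braided Casimir under the spin-(l/2) almost representation is a scalar matrix; explicitly, (q³+q)UW + V² + (q+q^{−1})WU = b_l b_{l+2} q^{2l−2} · Id, where b_n = (qⁿ − q^{−n})/(q − q^{−1}) and U, V, W are the explicit matrices of the spin-(l/2) construction. -/
open Matrix

noncomputable section

/-- The q-number `b_n = (q^n - q^{-n})/(q - q⁻¹)`. -/
def bq (q : ℂ) (n : ℤ) : ℂ := (q ^ n - q ^ (-n)) / (q - q⁻¹)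

/-- `y_i = b_i * b_{l+1-i}`. -/
def yq (l : ℕ) (q : ℂ) (i : ℕ) : ℂ := bq q (i : ℤ) * bq q ((l : ℤ) + 1 - (i : ℤ))

/-- The superdiagonal matrix of 1's: `X̂ e_{j+1} = e_j`. -/
def Xh (l : ℕ) : Matrix (Fin (l + 1)) (Fin (l + 1)) ℂ :=
  Matrix.of fun i j => if (j : ℕ) = (i : ℕ) + 1 then 1 else 0

/-- `Ĥ = diag(l, l-2, …, -l)`. -/
def Hh (l : ℕ) : Matrix (Fin (l + 1)) (Fin (l + 1)) ℂ :=
  Matrix.diagonal fun i => (l : ℂ) - 2 * ((i : ℕ) : ℂ)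

/-- `K = diag(q^l, q^{l-2}, …, q^{-l})`. -/
def Kh (l : ℕ) (q : ℂ) : Matrix (Fin (l + 1)) (Fin (l + 1)) ℂ :=
  Matrix.diagonal fun i => q ^ ((l : ℤ) - 2 * ((i : ℕ) : ℤ))

/-- `K⁻¹ = diag(q^{-l}, q^{2-l}, …, q^l)`. -/
def Khinv (l : ℕ) (q : ℂ) : Matrix (Fin (l + 1)) (Fin (l + 1)) ℂ :=
  Matrix.diagonal fun i => q ^ (2 * ((i : ℕ) : ℤ) - (l : ℤ))

/-- `Ŷ e_j = y_j e_{j+1}`. -/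
def Yh (l : ℕ) (q : ℂ) : Matrix (Fin (l + 1)) (Fin (l + 1)) ℂ :=
  Matrix.of fun i j => if (i : ℕ) = (j : ℕ) + 1 then yq l q ((j : ℕ) + 1) else 0

/-- Adjoint action of `X`: `ρ_End(X)M = X̂M − K⁻¹MKX̂`. -/
def rhoX (l : ℕ) (q : ℂ) (M : Matrix (Fin (l + 1)) (Fin (l + 1)) ℂ) :
    Matrix (Fin (l + 1)) (Fin (l + 1)) ℂ :=
  Xh l * M - Khinv l q * M * Kh l q * Xh l

/-- Adjoint action of `H`: `ρ_End(H)M = ĤM − MĤ`. -/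
def rhoH (l : ℕ) (M : Matrix (Fin (l + 1)) (Fin (l + 1)) ℂ) :
    Matrix (Fin (l + 1)) (Fin (l + 1)) ℂ :=
  Hh l * M - M * Hh l

/-- Adjoint action of `Y`: `ρ_End(Y)M = (ŶM − MŶ)K⁻¹`. -/
def rhoY (l : ℕ) (q : ℂ) (M : Matrix (Fin (l + 1)) (Fin (l + 1)) ℂ) :
    Matrix (Fin (l + 1)) (Fin (l + 1)) ℂ :=
  (Yh l q * M - M * Yh l q) * Khinv l q

/-- The superdiagonal matrix `U` with entries `(q^{2(l-1)}, …, q², 1)`. -/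
def Um (l : ℕ) (q : ℂ) : Matrix (Fin (l + 1)) (Fin (l + 1)) ℂ :=
  Matrix.of fun i j =>
    if (j : ℕ) = (i : ℕ) + 1 then q ^ (2 * ((l : ℤ) - 1 - ((i : ℕ) : ℤ))) else 0

/-- `V = −ρ_End(Y)U`. -/
def Vm (l : ℕ) (q : ℂ) : Matrix (Fin (l + 1)) (Fin (l + 1)) ℂ := -(rhoY l q (Um l q))

/-- `W = (q + q⁻¹)⁻¹ ρ_End(Y)V`. -/
def Wm (l : ℕ) (q : ℂ) : Matrix (Fin (l + 1)) (Fin (l + 1)) ℂ :=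
  (q + q⁻¹)⁻¹ • rhoY l q (Vm l q)

/-- The matrix with entries `a 0, …, a (l - 1)` on the superdiagonal. -/
def superdiagonal (l : ℕ) (a : ℤ → ℂ) : Matrix (Fin (l + 1)) (Fin (l + 1)) ℂ :=
  Matrix.of fun i j => if (j : ℕ) = (i : ℕ) + 1 then a (i : ℕ) else 0

/-- The matrix with entries `b 0, …, b (l - 1)` on the subdiagonal. -/
def subdiagonal (l : ℕ) (b : ℤ → ℂ) : Matrix (Fin (l + 1)) (Fin (l + 1)) ℂ :=
  Matrix.of fun i j => if (i : ℕ) = (j : ℕ) + 1 then b (j : ℕ) else 0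

theorem superdiagonal_mul_subdiagonal (l : ℕ) (a b : ℤ → ℂ) (hb : b l = 0) :
    superdiagonal l a * subdiagonal l b =
      Matrix.diagonal fun i : Fin (l + 1) => a (i : ℕ) * b (i : ℕ) := by
  ext ⟨i, hi⟩ ⟨j, hj⟩
  simp only [superdiagonal, subdiagonal, Matrix.mul_apply, Matrix.of_apply,
    Matrix.diagonal_apply, Fin.mk.injEq]
  by_cases hil : i = l
  · subst hil
    rw [Finset.sum_eq_zero]
    · simp [hb]
    · intro k _
      rw [if_neg (by have := k.2; omega), zero_mul]
  · rw [Finset.sum_eq_single (⟨i + 1, by omega⟩ : Fin (l + 1))]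
    · by_cases h : i = j <;> simp [h]
    · intro k _ hk
      rw [if_neg (fun h => hk (Fin.ext h)), zero_mul]
    · simp

theorem subdiagonal_mul_superdiagonal (l : ℕ) (a b : ℤ → ℂ) (hb : b (-1) = 0) :
    subdiagonal l b * superdiagonal l a =
      Matrix.diagonal fun i : Fin (l + 1) => b ((i : ℕ) - 1) * a ((i : ℕ) - 1) := by
  ext ⟨i, hi⟩ ⟨j, hj⟩
  simp only [superdiagonal, subdiagonal, Matrix.mul_apply, Matrix.of_apply,
    Matrix.diagonal_apply, Fin.mk.injEq]
  rcases i with _ | i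
  · rw [Finset.sum_eq_zero]
    · simp [hb]
    · intro k _
      rw [if_neg (by omega), zero_mul]
  · rw [Finset.sum_eq_single (⟨i, by omega⟩ : Fin (l + 1))]
    · by_cases h : i + 1 = j
      · subst h
        simp
      · simp [h, Ne.symm h]
    · intro k _ hk
      rw [if_neg (fun h => hk (Fin.ext (by simp at h ⊢; omega))), zero_mul]
    · simp

theorem subdiagonal_mul_diagonal (l : ℕ) (b d : ℤ → ℂ) :
    subdiagonal l b * Matrix.diagonal (fun i : Fin (l + 1) => d (i : ℕ)) =
      subdiagonal l fun i => b i * d i := by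
  ext i j
  simp [subdiagonal, Matrix.mul_diagonal]

theorem diagonal_mul_subdiagonal (l : ℕ) (b d : ℤ → ℂ) :
    Matrix.diagonal (fun i : Fin (l + 1) => d (i : ℕ)) * subdiagonal l b =
      subdiagonal l fun i => d (i + 1) * b i := by
  ext i j
  by_cases h : (i : ℕ) = j + 1 <;> simp [subdiagonal, Matrix.diagonal_mul, h]

@[simp]
theorem bq_zero (q : ℂ) : bq q 0 = 0 := by simp [bq]

/-- The product `b_i b_{l+1-i}` for an arbitrary integer `i`. -/
def yInt (l : ℕ) (q : ℂ) (i : ℤ) : ℂ := bq q i * bq q (l + 1 - i)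

/-- The diagonal entries of `V`. -/
def vEntry (l : ℕ) (q : ℂ) (i : ℤ) : ℂ :=
  q ^ ((l : ℤ) - 2) * (yInt l q (i + 1) - q ^ 2 * yInt l q i)

/-- The subdiagonal entries of `ρ_End(Y)V`. -/
def rhoYVEntry (l : ℕ) (q : ℂ) (i : ℤ) : ℂ :=
  yInt l q (i + 1) * (vEntry l q i - vEntry l q (i + 1)) * q ^ (2 * i - (l : ℤ))

@[simp]
theorem yInt_zero (l : ℕ) (q : ℂ) : yInt l q 0 = 0 := by simp [yInt]

@[simp]
theorem yInt_add_one (l : ℕ) (q : ℂ) : yInt l q (l + 1) = 0 := by simp [yInt]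

theorem yInt_eq (l : ℕ) {q : ℂ} (hq : q ≠ 0) (i : ℤ) :
    yInt l q i = (q ^ l * q + (q ^ l * q)⁻¹ - q ^ l * q * (q ^ i)⁻¹ ^ 2
      - (q ^ i) ^ 2 * (q ^ l * q)⁻¹) / (q - q⁻¹) ^ 2 := by
  have h : q ^ i ≠ 0 := zpow_ne_zero _ hq
  have hl : q ^ l ≠ 0 := pow_ne_zero _ hq
  simp only [yInt, bq, neg_sub, _root_.zpow_neg, zpow_sub₀ hq, zpow_add₀ hq, zpow_natCast,
    zpow_one]
  rw [div_mul_div_comm, ← sq]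
  congr 1
  field_simp
  ring

theorem vEntry_eq (l : ℕ) {q : ℂ} (hq : q ≠ 0) (i : ℤ) :
    vEntry l q i = q ^ l * (q ^ 2)⁻¹ * (1 - q ^ 2) * (q ^ l * q + (q ^ l * q)⁻¹
      - q ^ l * q⁻¹ * (1 + q ^ 2) * (q ^ i)⁻¹ ^ 2) / (q - q⁻¹) ^ 2 := by
  have h : q ^ i ≠ 0 := zpow_ne_zero _ hq
  have hl : q ^ l ≠ 0 := pow_ne_zero _ hq
  have h2 : q ^ ((l : ℤ) - 2) = q ^ l * (q ^ 2)⁻¹ := by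
    rw [zpow_sub₀ hq]; norm_cast
  rw [vEntry, yInt_eq l hq, yInt_eq l hq, h2, mul_div_assoc', ← sub_div, mul_div_assoc']
  congr 1
  simp only [zpow_add₀ hq, zpow_one]
  field_simp
  ring

theorem Um_eq_superdiagonal (l : ℕ) (q : ℂ) :
    Um l q = superdiagonal l fun i => q ^ (2 * ((l : ℤ) - 1 - i)) := rfl

theorem Yh_eq_subdiagonal (l : ℕ) (q : ℂ) :
    Yh l q = subdiagonal l fun i => yInt l q (i + 1) := by
  ext i j
  simp [Yh, subdiagonal, yInt, yq]

theorem Vm_eq_diagonal (l : ℕ) {q : ℂ} (hq : q ≠ 0) :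
    Vm l q = Matrix.diagonal fun i : Fin (l + 1) => vEntry l q (i : ℕ) := by
  rw [Vm, rhoY, Um_eq_superdiagonal, Yh_eq_subdiagonal,
    superdiagonal_mul_subdiagonal _ _ _ (by simp),
    subdiagonal_mul_superdiagonal _ _ _ (by simp), Khinv, Matrix.diagonal_sub,
    Matrix.diagonal_mul_diagonal, Matrix.diagonal_neg]
  congr 1
  ext i
  have h₁ : q ^ (2 * ((l : ℤ) - 1 - (i : ℕ))) * q ^ (2 * ((i : ℕ) : ℤ) - l) =
      q ^ ((l : ℤ) - 2) := by
    rw [← zpow_add₀ hq]; congr 1; ring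
  have h₂ : q ^ (2 * ((l : ℤ) - 1 - ((i : ℕ) - 1))) * q ^ (2 * ((i : ℕ) : ℤ) - l) =
      q ^ ((l : ℤ) - 2) * q ^ 2 := by
    rw [← zpow_add₀ hq, ← zpow_natCast q 2, ← zpow_add₀ hq]; congr 1; push_cast; ring
  simp only [vEntry, sub_add_cancel]
  linear_combination yInt l q ((i : ℕ) + 1) * h₁ - yInt l q (i : ℕ) * h₂

theorem rhoY_Vm_eq_subdiagonal (l : ℕ) {q : ℂ} (hq : q ≠ 0) :
    rhoY l q (Vm l q) = subdiagonal l (rhoYVEntry l q) := by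
  rw [rhoY, Vm_eq_diagonal l hq, Yh_eq_subdiagonal, subdiagonal_mul_diagonal,
    diagonal_mul_subdiagonal, Khinv]
  ext i j
  simp only [subdiagonal, rhoYVEntry, Matrix.mul_diagonal, Matrix.sub_apply, Matrix.of_apply]
  split_ifs <;> ring

theorem vEntry_sub_vEntry_add_one (l : ℕ) {q : ℂ} (hq : q ≠ 0) (i : ℤ) :
    vEntry l q i - vEntry l q (i + 1) =
      (q + q⁻¹) * (q ^ l) ^ 2 * (q ^ 2)⁻¹ * (1 - q ^ 2) ^ 2 * (q ^ i)⁻¹ ^ 2 * (q ^ 2)⁻¹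
        / (q - q⁻¹) ^ 2 := by
  have h : q ^ i ≠ 0 := zpow_ne_zero _ hq
  have hl : q ^ l ≠ 0 := pow_ne_zero _ hq
  rw [vEntry_eq l hq, vEntry_eq l hq, ← sub_div]
  congr 1
  simp only [zpow_add₀ hq, zpow_one]
  field_simp
  ring

/-- The identity also holds when `q + q⁻¹ = 0`, as then `ρ_End(Y)V = 0`. -/
theorem add_inv_smul_Wm (l : ℕ) {q : ℂ} (hq : q ≠ 0) :
    (q + q⁻¹) • Wm l q = rhoY l q (Vm l q) := by
  rw [Wm, smul_smul]
  by_cases h : q + q⁻¹ = 0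
  · rw [rhoY_Vm_eq_subdiagonal l hq]
    ext i j
    simp [subdiagonal, rhoYVEntry, vEntry_sub_vEntry_add_one l hq, h]
  · rw [mul_inv_cancel₀ h, one_smul]

theorem casimir_entry (l : ℕ) {q : ℂ} (hq : q ≠ 0) (hq2 : q ^ 2 ≠ 1) (i : ℤ) :
    q ^ 2 * (q ^ (2 * ((l : ℤ) - 1 - i)) * rhoYVEntry l q i) + vEntry l q i * vEntry l q i
      + rhoYVEntry l q (i - 1) * q ^ (2 * ((l : ℤ) - 1 - (i - 1)))
      = bq q l * bq q (l + 2) * q ^ (2 * (l : ℤ) - 2) := by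
  have h : q ^ i ≠ 0 := zpow_ne_zero _ hq
  have hl : q ^ l ≠ 0 := pow_ne_zero _ hq
  have h₁ (k : ℤ) : q ^ (2 * ((l : ℤ) - 1 - k)) * q ^ (2 * k - (l : ℤ)) =
      q ^ l * (q ^ 2)⁻¹ := by
    rw [← zpow_add₀ hq, ← zpow_natCast q l, ← zpow_natCast q 2, ← _root_.zpow_neg,
      ← zpow_add₀ hq]
    congr 1; push_cast; ring
  have h₂ : q ^ (2 * (l : ℤ) - 2) = (q ^ l) ^ 2 * (q ^ 2)⁻¹ := by
    rw [zpow_sub₀ hq, ← pow_mul, mul_comm l]; norm_cast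
  have h₃ : bq q l * bq q (l + 2) =
      (q ^ l - (q ^ l)⁻¹) * (q ^ l * q ^ 2 - (q ^ l * q ^ 2)⁻¹) / (q - q⁻¹) ^ 2 := by
    rw [bq, bq, div_mul_div_comm, ← sq, _root_.zpow_neg, _root_.zpow_neg, zpow_add₀ hq]; norm_cast
  have key : q ^ 2 * (q ^ l * (q ^ 2)⁻¹) * (yInt l q (i + 1) *
        (vEntry l q i - vEntry l q (i + 1)))
      + vEntry l q i * vEntry l q i
      + q ^ l * (q ^ 2)⁻¹ * (yInt l q i * (vEntry l q (i - 1) - vEntry l q (i - 1 + 1)))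
      = bq q l * bq q (l + 2) * q ^ (2 * (l : ℤ) - 2) := by
    rw [h₂, h₃, vEntry_sub_vEntry_add_one l hq, vEntry_sub_vEntry_add_one l hq,
      yInt_eq l hq, yInt_eq l hq, vEntry_eq l hq]
    simp only [zpow_add₀ hq, zpow_sub₀ hq, zpow_one]
    have hd' : q ^ 2 - 1 ≠ 0 := sub_ne_zero.2 hq2
    have hd2 : q - q⁻¹ = (q ^ 2 - 1) / q := by field_simp
    rw [hd2]
    generalize q ^ i = x at *
    generalize q ^ l = A at *
    field_simp
    ring
  rw [← key, rhoYVEntry, rhoYVEntry, sub_add_cancel]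
  linear_combination q ^ 2 * yInt l q (i + 1) * (vEntry l q i - vEntry l q (i + 1)) * h₁ i
    + yInt l q i * (vEntry l q (i - 1) - vEntry l q i) * h₁ (i - 1)

/-- the image of the braided Casimir under the spin-(l/2) almost
representation is the scalar matrix `b_l b_{l+2} q^{2l-2} · Id`. -/
theorem braided_casimir_is_scalar (l : ℕ) (hl : 1 ≤ l) (q : ℂ) (hq : q ≠ 0)
    (hq2 : q ^ 2 ≠ 1) :
    (q ^ 3 + q) • (Um l q * Wm l q) + Vm l q * Vm l q + (q + q⁻¹) • (Wm l q * Um l q)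
      = (bq q (l : ℤ) * bq q ((l : ℤ) + 2) * q ^ (2 * (l : ℤ) - 2)) • 1 := by
  have hc : q ^ 3 + q = q ^ 2 * (q + q⁻¹) := by field_simp
  rw [hc, mul_smul, ← Matrix.mul_smul _ (q + q⁻¹), ← Matrix.smul_mul (q + q⁻¹) (Wm l q),
    add_inv_smul_Wm l hq, rhoY_Vm_eq_subdiagonal l hq, Vm_eq_diagonal l hq, Um_eq_superdiagonal,
    superdiagonal_mul_subdiagonal _ _ _ (by simp [rhoYVEntry]),
    subdiagonal_mul_superdiagonal _ _ _ (by simp [rhoYVEntry]),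
    Matrix.diagonal_mul_diagonal, ← Matrix.diagonal_smul, Matrix.diagonal_add,
    Matrix.diagonal_add, Matrix.smul_one_eq_diagonal]
  congr 1
  ext i
  exact casimir_entry l hq hq2 (i : ℕ)
end
end

section
/- Let l ≥ 1 be an integer and q a nonzero complex number with q² ≠ 1. The matrix V = −ρ_End(Y)U of the spin-(l/2) construction is a diagonal matrix, the matrix W = (q+q^{−1})^{−1}ρ_End(Y)V has nonzero entries only on the subdiagonal, and the first two diagonal entries of V are v₁ = y₁q^{l−2} and v₂ = y₂q^{l−2} − y₁q^{l}. -/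
open Matrix

noncomputable section

/-- The action of `Y` lowers the grading of matrices by diagonals by one. -/
lemma rhoY_apply_eq_zero {l : ℕ} (q : ℂ) {M : Matrix (Fin (l + 1)) (Fin (l + 1)) ℂ} {k : ℤ}
    (hM : ∀ i j : Fin (l + 1), ((j : ℕ) : ℤ) ≠ (i : ℕ) + k → M i j = 0)
    {i j : Fin (l + 1)} (hij : ((j : ℕ) : ℤ) ≠ (i : ℕ) + (k - 1)) :
    rhoY l q M i j = 0 := by
  have hYM : (Yh l q * M) i j = 0 := by
    rw [Matrix.mul_apply]
    refine Finset.sum_eq_zero fun m _ => ?_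
    by_cases h : (i : ℕ) = m + 1
    · rw [hM m j (by omega), mul_zero]
    · simp [Yh, h]
  have hMY : (M * Yh l q) i j = 0 := by
    rw [Matrix.mul_apply]
    refine Finset.sum_eq_zero fun m _ => ?_
    by_cases h : (m : ℕ) = j + 1
    · rw [hM i m (by omega), zero_mul]
    · simp [Yh, h]
  simp [rhoY, Khinv, hYM, hMY]

lemma Vm_apply_eq_zero {l : ℕ} (q : ℂ) {i j : Fin (l + 1)} (hij : i ≠ j) :
    Vm l q i j = 0 := by
  have hU : ∀ i j : Fin (l + 1), ((j : ℕ) : ℤ) ≠ (i : ℕ) + 1 → Um l q i j = 0 := fun i j h => by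
    have h' : (j : ℕ) ≠ i + 1 := by omega
    simp [Um, h']
  simp [Vm, rhoY_apply_eq_zero q hU (i := i) (j := j) (by omega)]

lemma Wm_apply_eq_zero {l : ℕ} (q : ℂ) {i j : Fin (l + 1)} (hij : (i : ℕ) ≠ j + 1) :
    Wm l q i j = 0 := by
  have hV : ∀ i j : Fin (l + 1), ((j : ℕ) : ℤ) ≠ (i : ℕ) + 0 → Vm l q i j = 0 := fun i j h =>
    Vm_apply_eq_zero q (by omega)
  simp [Wm, rhoY_apply_eq_zero q hV (i := i) (j := j) (by omega)]

lemma yq_zero (l : ℕ) (q : ℂ) : yq l q 0 = 0 := by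
  simp [yq, bq]

lemma yq_add_one_self (l : ℕ) (q : ℂ) : yq l q (l + 1) = 0 := by
  simp [yq, bq]

lemma Um_mul_Yh_apply_self (l : ℕ) (q : ℂ) (i : Fin (l + 1)) :
    (Um l q * Yh l q) i i = q ^ (2 * ((l : ℤ) - 1 - (i : ℕ))) * yq l q (i + 1) := by
  rw [Matrix.mul_apply]
  by_cases hi : (i : ℕ) = l
  · rw [hi, yq_add_one_self, mul_zero]
    refine Finset.sum_eq_zero fun m _ => ?_
    have hm : (m : ℕ) ≠ i + 1 := by omega
    simp [Um, hm]
  · rw [Finset.sum_eq_single (⟨i + 1, by omega⟩ : Fin (l + 1))]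
    · simp [Um, Yh]
    · intro m _ hm
      have hm' : (m : ℕ) ≠ i + 1 := fun h => hm (Fin.ext h)
      simp [Um, hm']
    · simp

lemma Yh_mul_Um_apply_self (l : ℕ) (q : ℂ) (i : Fin (l + 1)) :
    (Yh l q * Um l q) i i = yq l q i * q ^ (2 * ((l : ℤ) - (i : ℕ))) := by
  rw [Matrix.mul_apply]
  by_cases hi : (i : ℕ) = 0
  · rw [hi, yq_zero, zero_mul]
    refine Finset.sum_eq_zero fun m _ => ?_
    have hm : (i : ℕ) ≠ m + 1 := by omega
    simp [Yh, hm]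
  · have hi' : (i : ℕ) = i - 1 + 1 := by omega
    rw [Finset.sum_eq_single (⟨i - 1, by omega⟩ : Fin (l + 1))]
    · have he : (l : ℤ) - 1 - ((i - 1 : ℕ) : ℤ) = l - (i : ℕ) := by omega
      simp only [Yh, Um, Matrix.of_apply, ← hi', he, if_true]
    · intro m _ hm
      have hm' : (i : ℕ) ≠ m + 1 := fun h => hm (Fin.ext (by simp only; omega))
      simp [Yh, hm']
    · simp

lemma Vm_apply_self (l : ℕ) {q : ℂ} (hq : q ≠ 0) (i : Fin (l + 1)) :
    Vm l q i i = yq l q (i + 1) * q ^ ((l : ℤ) - 2) - yq l q i * q ^ (l : ℤ) := by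
  have h₁ : q ^ ((l : ℤ) - 2) =
      q ^ (2 * ((l : ℤ) - 1 - (i : ℕ))) * q ^ (2 * ((i : ℕ) : ℤ) - l) := by
    rw [← zpow_add₀ hq]
    congr 1
    ring
  have h₂ : q ^ (l : ℤ) = q ^ (2 * ((l : ℤ) - (i : ℕ))) * q ^ (2 * ((i : ℕ) : ℤ) - l) := by
    rw [← zpow_add₀ hq]
    congr 1
    ring
  rw [Vm, rhoY, Khinv, Matrix.neg_apply, Matrix.mul_diagonal, Matrix.sub_apply,
    Um_mul_Yh_apply_self, Yh_mul_Um_apply_self, h₁, h₂]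
  ring

/-- `V = −ρ_End(Y)U` is diagonal, `W = (q+q⁻¹)⁻¹ρ_End(Y)V` is subdiagonal,
and the first two diagonal entries of `V` are `v₁ = y₁q^{l−2}`, `v₂ = y₂q^{l−2} − y₁q^l`. -/
theorem V_diagonal_W_subdiagonal (l : ℕ) (hl : 1 ≤ l) (q : ℂ) (hq : q ≠ 0)
    (hq2 : q ^ 2 ≠ 1) :
    (∀ i j : Fin (l + 1), i ≠ j → Vm l q i j = 0) ∧
    (∀ i j : Fin (l + 1), (i : ℕ) ≠ (j : ℕ) + 1 → Wm l q i j = 0) ∧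
    Vm l q 0 0 = yq l q 1 * q ^ ((l : ℤ) - 2) ∧
    Vm l q 1 1 = yq l q 2 * q ^ ((l : ℤ) - 2) - yq l q 1 * q ^ (l : ℤ) := by
  refine ⟨fun i j => Vm_apply_eq_zero q, fun i j => Wm_apply_eq_zero q, ?_, ?_⟩
  · simpa [yq_zero] using Vm_apply_self l hq 0
  · have h : ((1 : Fin (l + 1)) : ℕ) = 1 := by
      rw [Fin.val_one', Nat.mod_eq_of_lt (by omega)]
    simpa only [h] using Vm_apply_self l hq 1
end
end
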